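/- Let ψ₁ be the modified stream function, i.e. an axially symmetric smooth solution of −ψ_{1,rr} − (3/r)ψ_{1,r} − ψ_{1,zz} = Γ in Ω with ψ₁ = 0 on S, where Γ is axially symmetric, smooth, and vanishes on S, and ψ₁ admits the expansion ψ₁ = d₁(z) + d₂(z)r² + … near the axis. Then for every μ ∈ (0,1) there is a constant c > 0 (independent of ψ₁, Γ, μ) such that ∫_Ω (ψ_{1,zzz}² + ψ_{1,rzz}²) r^{2μ} dx + 2μ(1−μ) ∫_Ω ψ_{1,zz}² r^{2μ−2} dx ≤ c ∫_Ω Γ_{,z}² r^{2μ} dx. -/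

import Mathlib

open MeasureTheory Real Set
open scoped ENNReal

noncomputable section

/-- The half-strip `(0,R) × (-a,a)` of `(r,z)` coordinates describing the cylinder
`Ω = {x ∈ ℝ³ : x₁² + x₂² < R², |x₃| < a}`. -/
def cylStrip (R a : ℝ) : Set (ℝ × ℝ) := Ioo 0 R ×ˢ Ioo (-a) a

/-- The measure on the `(r,z)` half-strip corresponding to Lebesgue measure on the
cylinder `Ω` for axially symmetric integrands: `dμ = 2π r dr dz`. -/
def cylMeas (R a : ℝ) : Measure (ℝ × ℝ) :=
  ((volume : Measure (ℝ × ℝ)).restrict (cylStrip R a)).withDensity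
    fun q => ENNReal.ofReal (2 * π * q.1)

/-- `∂_r` of a function of `(r,z)`. -/
def qdr (w : ℝ → ℝ → ℝ) : ℝ → ℝ → ℝ := fun r z => deriv (fun s => w s z) r
/-- `∂_z` of a function of `(r,z)`. -/
def qdz (w : ℝ → ℝ → ℝ) : ℝ → ℝ → ℝ := fun r z => deriv (fun s => w r s) z

/-- Hypotheses on the modified stream function `ψ₁` and the datum `Γ`:
smoothness, axial symmetry (built in: functions of `(r,z)`), the equation
`−ψ₁,rr − (3/r)ψ₁,r − ψ₁,zz = Γ` in `Ω`, `ψ₁ = 0` and `Γ = 0` on `S`, and the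
behaviour `ψ₁,r, ψ₁,rz, ψ₁,rzz = O(r)` near the axis coming from the expansion
`ψ₁ = d₁(z) + d₂(z) r² + …`. -/
structure ModStream (R a : ℝ) (ψ Γ : ℝ → ℝ → ℝ) : Prop where
  smooth_ψ : ∀ n : ℕ, ContDiff ℝ n (fun q : ℝ × ℝ => ψ q.1 q.2)
  smooth_Γ : ∀ n : ℕ, ContDiff ℝ n (fun q : ℝ × ℝ => Γ q.1 q.2)
  eqn : ∀ r z, (r, z) ∈ cylStrip R a →
    - qdr (qdr ψ) r z - (3 / r) * qdr ψ r z - qdz (qdz ψ) r z = Γ r z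
  ψ_lat : ∀ z ∈ Icc (-a) a, ψ R z = 0
  ψ_top : ∀ r ∈ Icc (0:ℝ) R, ψ r a = 0 ∧ ψ r (-a) = 0
  Γ_lat : ∀ z ∈ Icc (-a) a, Γ R z = 0
  Γ_top : ∀ r ∈ Icc (0:ℝ) R, Γ r a = 0 ∧ Γ r (-a) = 0
  axis : ∃ C : ℝ, ∀ r ∈ Ioo (0:ℝ) R, ∀ z ∈ Icc (-a) a,
    |qdr ψ r z| ≤ C * r ∧ |qdr (qdz ψ) r z| ≤ C * r ∧ |qdr (qdz (qdz ψ)) r z| ≤ C * r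


/-- The function of two variables `w` is smooth on the whole plane. -/
def PlaneSmooth (w : ℝ → ℝ → ℝ) : Prop := ContDiff ℝ (⊤ : ℕ∞) (fun q : ℝ × ℝ => w q.1 q.2)

namespace PlaneSmooth

variable {w : ℝ → ℝ → ℝ}

theorem differentiable (hw : PlaneSmooth w) : Differentiable ℝ (fun q : ℝ × ℝ => w q.1 q.2) :=
  ContDiff.differentiable hw (by simp)

theorem qdr_eq (hw : PlaneSmooth w) (r z : ℝ) :
    qdr w r z = fderiv ℝ (fun q : ℝ × ℝ => w q.1 q.2) (r, z) (1, 0) := by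
  have h1 : HasDerivAt (fun s : ℝ => ((s, z) : ℝ × ℝ)) (1, 0) r :=
    (hasDerivAt_id r).prodMk (hasDerivAt_const r z)
  exact ((hw.differentiable (r, z)).hasFDerivAt.comp_hasDerivAt r h1).deriv

theorem qdz_eq (hw : PlaneSmooth w) (r z : ℝ) :
    qdz w r z = fderiv ℝ (fun q : ℝ × ℝ => w q.1 q.2) (r, z) (0, 1) := by
  have h1 : HasDerivAt (fun s : ℝ => ((r, s) : ℝ × ℝ)) (0, 1) z :=
    (hasDerivAt_const z r).prodMk (hasDerivAt_id z)
  exact ((hw.differentiable (r, z)).hasFDerivAt.comp_hasDerivAt z h1).deriv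

theorem qdr (hw : PlaneSmooth w) : PlaneSmooth (qdr w) := by
  unfold PlaneSmooth
  simp only [hw.qdr_eq]
  exact (ContDiff.fderiv_right hw (m := (⊤ : ℕ∞)) (by simp)).clm_apply contDiff_const

theorem qdz (hw : PlaneSmooth w) : PlaneSmooth (qdz w) := by
  unfold PlaneSmooth
  simp only [hw.qdz_eq]
  exact (ContDiff.fderiv_right hw (m := (⊤ : ℕ∞)) (by simp)).clm_apply contDiff_const

theorem hasDerivAt_fst (hw : PlaneSmooth w) (r z : ℝ) :
    HasDerivAt (fun s => w s z) (_root_.qdr w r z) r := by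
  have h1 : Differentiable ℝ (fun s : ℝ => w s z) :=
    hw.differentiable.comp (f := fun s : ℝ => ((s, z) : ℝ × ℝ)) (by fun_prop)
  exact (h1 r).hasDerivAt

theorem hasDerivAt_snd (hw : PlaneSmooth w) (r z : ℝ) :
    HasDerivAt (fun s => w r s) (_root_.qdz w r z) z := by
  have h1 : Differentiable ℝ (fun s : ℝ => w r s) :=
    hw.differentiable.comp (f := fun s : ℝ => ((r, s) : ℝ × ℝ)) (by fun_prop)
  exact (h1 z).hasDerivAt

theorem qdz_qdr (hw : PlaneSmooth w) : _root_.qdz (_root_.qdr w) = _root_.qdr (_root_.qdz w) := by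
  funext r z
  have hd : Differentiable ℝ (fderiv ℝ (fun q : ℝ × ℝ => w q.1 q.2)) :=
    (ContDiff.fderiv_right hw (m := (⊤ : ℕ∞)) (by simp)).differentiable (by simp)
  have hs : IsSymmSndFDerivAt ℝ (fun q : ℝ × ℝ => w q.1 q.2) (r, z) :=
    ContDiffAt.isSymmSndFDerivAt (n := (⊤ : ℕ∞)) (ContDiff.contDiffAt hw)
      (by simpa using WithTop.coe_le_coe.2 (le_top : (2 : ℕ∞) ≤ ⊤))
  rw [hw.qdr.qdz_eq, hw.qdz.qdr_eq]
  simp only [hw.qdr_eq, hw.qdz_eq]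
  rw [fderiv_clm_apply (hd _) (by fun_prop), fderiv_clm_apply (hd _) (by fun_prop)]
  simpa using hs (0, 1) (1, 0)

theorem continuous (hw : PlaneSmooth w) : Continuous (fun q : ℝ × ℝ => w q.1 q.2) :=
  ContDiff.continuous hw

theorem continuous_snd (hw : PlaneSmooth w) (r : ℝ) : Continuous (w r) :=
  hw.continuous.comp (f := fun s : ℝ => ((r, s) : ℝ × ℝ)) (by fun_prop)

end PlaneSmooth

/-- The equation `−w,rr − (3/r)w,r − w,zz = G` on the half-strip. -/
def StreamEq (R a : ℝ) (w G : ℝ → ℝ → ℝ) : Prop :=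
  ∀ r z, (r, z) ∈ cylStrip R a →
    - qdr (qdr w) r z - (3 / r) * qdr w r z - qdz (qdz w) r z = G r z

theorem StreamEq.qdz {R a : ℝ} {w G : ℝ → ℝ → ℝ} (hw : PlaneSmooth w)
    (hG : PlaneSmooth G) (h : StreamEq R a w G) : StreamEq R a (qdz w) (qdz G) := by
  intro r z hq
  have h1 : (fun s => - qdr (qdr w) r s - (3 / r) * qdr w r s - _root_.qdz (_root_.qdz w) r s)
      =ᶠ[nhds z] fun s => G r s := by
    filter_upwards [Ioo_mem_nhds hq.2.1 hq.2.2] with s hs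
    exact h r s ⟨hq.1, hs⟩
  have h2 := ((hw.qdr.qdr.hasDerivAt_snd r z).neg.sub
    ((hw.qdr.hasDerivAt_snd r z).const_mul (3 / r))).sub (hw.qdz.qdz.hasDerivAt_snd r z)
  have h3 := (h2.congr_of_eventuallyEq h1.symm).unique (hG.hasDerivAt_snd r z)
  rw [← h3, hw.qdr.qdz_qdr, hw.qdz_qdr]

/-- Continuous functions times a power of `r` larger than `-1` are integrable on the strip. -/
theorem integrableOn_mul_rpow (R a : ℝ) (hR : 0 < R) {p : ℝ} (hp : -1 < p) {g : ℝ × ℝ → ℝ}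
    (hg : Continuous g) :
    IntegrableOn (fun q => g q * q.1 ^ p) (Icc ((0 : ℝ), -a) (R, a)) := by
  refine IntegrableOn.continuousOn_mul hg.continuousOn ?_ isCompact_Icc
  rw [← Icc_prod_Icc, IntegrableOn, Measure.volume_eq_prod, ← Measure.prod_restrict]
  have h1 : IntegrableOn (fun r : ℝ => r ^ p) (Icc 0 R) := by
    have := intervalIntegral.intervalIntegrable_rpow' (a := 0) (b := R) hp
    rwa [intervalIntegrable_iff_integrableOn_Icc_of_le hR.le] at this
  have h2 : IntegrableOn (fun _ : ℝ => (1 : ℝ)) (Icc (-a) a) := by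
    simp
  simpa using Integrable.mul_prod h1 h2

theorem measurableSet_cylStrip (R a : ℝ) : MeasurableSet (cylStrip R a) :=
  measurableSet_Ioo.prod measurableSet_Ioo

theorem Icc_ae_eq_cylStrip (R a : ℝ) :
    (Icc ((0 : ℝ), -a) (R, a) : Set (ℝ × ℝ)) =ᵐ[volume] cylStrip R a := by
  rw [← Icc_prod_Icc, Measure.volume_eq_prod]
  exact (Measure.set_prod_ae_eq Ioo_ae_eq_Icc Ioo_ae_eq_Icc).symm

theorem integral_cylMeas (R a : ℝ) (f : ℝ × ℝ → ℝ) :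
    ∫ q, f q ∂(cylMeas R a) = 2 * π * ∫ q in Icc ((0 : ℝ), -a) (R, a), q.1 * f q := by
  have hae := Icc_ae_eq_cylStrip R a
  rw [setIntegral_congr_set hae, ← integral_const_mul, cylMeas,
    integral_withDensity_eq_integral_toReal_smul (by fun_prop) (by simp)]
  refine setIntegral_congr_fun (measurableSet_cylStrip R a) fun q hq => ?_
  have : 0 < q.1 := hq.1.1
  simp only [smul_eq_mul]
  rw [ENNReal.toReal_ofReal (by positivity)]
  ring

namespace ModStream

variable {R a : ℝ} {ψ Γ : ℝ → ℝ → ℝ}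

theorem planeSmooth_ψ (h : ModStream R a ψ Γ) : PlaneSmooth ψ := contDiff_infty.2 h.smooth_ψ

theorem planeSmooth_Γ (h : ModStream R a ψ Γ) : PlaneSmooth Γ := contDiff_infty.2 h.smooth_Γ

theorem qdz_qdz_lat (h : ModStream R a ψ Γ) {z : ℝ} (hz : z ∈ Ioo (-a) a) :
    qdz (qdz ψ) R z = 0 := by
  have h0 : ∀ {w : ℝ → ℝ → ℝ}, (∀ z ∈ Ioo (-a) a, w R z = 0) → ∀ z ∈ Ioo (-a) a,
      qdz w R z = 0 := by
    intro w hw z hz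
    have : (fun s => w R s) =ᶠ[nhds z] fun _ => 0 := by
      filter_upwards [Ioo_mem_nhds hz.1 hz.2] with s hs using hw s hs
    simp [qdz, this.deriv_eq]
  exact h0 (h0 fun z hz => h.ψ_lat z (Ioo_subset_Icc_self hz)) z hz

theorem qdz_qdz_top (h : ModStream R a ψ Γ) {r z : ℝ} (hr : r ∈ Ioo 0 R)
    (ha : 0 < a) (hz : z = a ∨ z = -a) : qdz (qdz ψ) r z = 0 := by
  have h0 : ∀ {w : ℝ → ℝ → ℝ}, (∀ r ∈ Ioo 0 R, w r z = 0) → ∀ r ∈ Ioo 0 R, qdr w r z = 0 := by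
    intro w hw r hr
    have : (fun s => w s z) =ᶠ[nhds r] fun _ => 0 := by
      filter_upwards [Ioo_mem_nhds hr.1 hr.2] with s hs using hw s hs
    simp [qdr, this.deriv_eq]
  have hψ : ∀ r ∈ Ioo 0 R, ψ r z = 0 := fun r hr => by
    have := h.ψ_top r (Ioo_subset_Icc_self hr)
    rcases hz with rfl | rfl
    exacts [this.1, this.2]
  have hΓ : Γ r z = 0 := by
    have := h.Γ_top r (Ioo_subset_Icc_self hr)
    rcases hz with rfl | rfl
    exacts [this.1, this.2]
  have hz' : z ∈ closure (Ioo (-a) a) := by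
    rw [closure_Ioo (by linarith)]
    rcases hz with rfl | rfl <;> constructor <;> linarith
  have hψs := h.planeSmooth_ψ
  have hE : EqOn (fun s => - qdr (qdr ψ) r s - (3 / r) * qdr ψ r s - qdz (qdz ψ) r s)
      (Γ r) (closure (Ioo (-a) a)) := by
    refine EqOn.closure (fun s hs => h.eqn r s ⟨hr, hs⟩) ?_ (h.planeSmooth_Γ.continuous_snd r)
    exact ((hψs.qdr.qdr.continuous_snd r).neg.sub
      (continuous_const.mul (hψs.qdr.continuous_snd r))).sub (hψs.qdz.qdz.continuous_snd r)
  have := hE hz'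
  simp only [hΓ, h0 hψ r hr, h0 (h0 hψ) r hr] at this
  linarith

end ModStream

/-- The weighted energy identity for solutions of the stream equation vanishing on the boundary
of the half-strip (except at the axis). -/
theorem weighted_energy_identity {R a : ℝ} (hR : 0 < R) (ha : 0 < a) {w G : ℝ → ℝ → ℝ}
    (hw : PlaneSmooth w) (hG : PlaneSmooth G) (h : StreamEq R a w (qdz G))
    (hlat : ∀ z ∈ Ioo (-a) a, w R z = 0)
    (htop : ∀ r ∈ Ioo 0 R, w r a = 0) (hbot : ∀ r ∈ Ioo 0 R, w r (-a) = 0)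
    {μ : ℝ} (hμ : μ ∈ Ioo (0 : ℝ) 1) :
    ∫ q in Icc ((0 : ℝ), -a) (R, a),
      (((qdz w q.1 q.2) ^ 2 + (qdr w q.1 q.2) ^ 2 + G q.1 q.2 * qdz w q.1 q.2)
          * q.1 ^ (2 * μ + 1)
        + 2 * μ * (1 - μ) * ((w q.1 q.2) ^ 2 * q.1 ^ (2 * μ - 1))) = 0 := by
  obtain ⟨hμ0, hμ1⟩ := hμ
  set A : ℝ × ℝ → ℝ := fun q => qdr w q.1 q.2 * w q.1 q.2 * q.1 ^ (2 * μ + 1)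
    + (1 - μ) * (w q.1 q.2) ^ 2 * q.1 ^ (2 * μ) with hA
  set B : ℝ × ℝ → ℝ := fun q => (qdz w q.1 q.2 + G q.1 q.2) * w q.1 q.2 * q.1 ^ (2 * μ + 1)
    with hB
  set E : ℝ × ℝ → ℝ := fun q =>
    ((qdz w q.1 q.2) ^ 2 + (qdr w q.1 q.2) ^ 2 + G q.1 q.2 * qdz w q.1 q.2) * q.1 ^ (2 * μ + 1)
        + 2 * μ * (1 - μ) * ((w q.1 q.2) ^ 2 * q.1 ^ (2 * μ - 1)) with hE
  have cw := hw.continuous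
  have cwr := hw.qdr.continuous
  have cwz := hw.qdz.continuous
  have cG := hG.continuous
  have cpow : ∀ {p : ℝ}, 0 ≤ p → Continuous fun q : ℝ × ℝ => q.1 ^ p := fun hp =>
    (Real.continuous_rpow_const hp).comp continuous_fst
  have cA : Continuous A :=
    ((cwr.mul cw).mul (cpow (by linarith))).add
      ((continuous_const.mul (cw.pow 2)).mul (cpow (by linarith)))
  have cB : Continuous B := ((cwz.add cG).mul cw).mul (cpow (by linarith))
  have dpow : ∀ (p : ℝ) {q : ℝ × ℝ}, 0 < q.1 →
      DifferentiableAt ℝ (fun q : ℝ × ℝ => q.1 ^ p) q := fun p q hq =>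
    (differentiableAt_fst).rpow_const (Or.inl hq.ne')
  have dA : ∀ {q : ℝ × ℝ}, 0 < q.1 → DifferentiableAt ℝ A q := fun {q} hq =>
    (((hw.qdr.differentiable q).mul (hw.differentiable q)).mul (dpow _ hq)).add
      (((differentiableAt_const _).mul ((hw.differentiable q).pow 2)).mul (dpow _ hq))
  have dB : ∀ {q : ℝ × ℝ}, 0 < q.1 → DifferentiableAt ℝ B q := fun {q} hq =>
    (((hw.qdz.differentiable q).add (hG.differentiable q)).mul (hw.differentiable q)).mul
      (dpow _ hq)
  have key : ∀ q ∈ cylStrip R a, fderiv ℝ A q (1, 0) + fderiv ℝ B q (0, 1) = E q := by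
    rintro ⟨r, z⟩ hq
    have hr : 0 < r := hq.1.1
    have eA : fderiv ℝ A (r, z) (1, 0) = deriv (fun s => A (s, z)) r :=
      ((dA (q := (r, z)) hr).hasFDerivAt.comp_hasDerivAt r
        ((hasDerivAt_id r).prodMk (hasDerivAt_const r z))).deriv.symm
    have eB : fderiv ℝ B (r, z) (0, 1) = deriv (fun s => B (r, s)) z :=
      ((dB (q := (r, z)) hr).hasFDerivAt.comp_hasDerivAt z
        ((hasDerivAt_const z r).prodMk (hasDerivAt_id z))).deriv.symm
    have p1 : HasDerivAt (fun s : ℝ => s ^ (2 * μ + 1)) _ r :=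
      Real.hasDerivAt_rpow_const (p := 2 * μ + 1) (Or.inl hr.ne')
    have p2 : HasDerivAt (fun s : ℝ => s ^ (2 * μ)) _ r :=
      Real.hasDerivAt_rpow_const (p := 2 * μ) (Or.inl hr.ne')
    have kA := (((hw.qdr.hasDerivAt_fst r z).mul (hw.hasDerivAt_fst r z)).mul p1).add
      ((((hw.hasDerivAt_fst r z).pow 2).const_mul (1 - μ)).mul p2)
    have kB := ((((hw.qdz.hasDerivAt_snd r z).add (hG.hasDerivAt_snd r z)).mul
      (hw.hasDerivAt_snd r z)).mul_const (r ^ (2 * μ + 1)))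
    have e1 : r ^ (2 * μ + 1) = r ^ (2 * μ - 1) * r ^ 2 := by
      rw [← Real.rpow_natCast, ← Real.rpow_add hr]; congr 1; push_cast; ring
    have e2 : r ^ (2 * μ) = r ^ (2 * μ - 1) * r := by
      rw [← Real.rpow_add_one hr.ne']; congr 1; ring
    have kA' : deriv (fun s => A (s, z)) r = _ := kA.deriv
    have kB' : deriv (fun s => B (r, s)) z = _ := kB.deriv
    have heq := h r z hq
    rw [eA, eB, kA', kB', hE]
    simp only [Pi.mul_apply, Pi.add_apply, Pi.pow_apply, add_sub_cancel_right]
    rw [← heq, e1, e2]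
    field_simp
    ring
  have hae := Icc_ae_eq_cylStrip R a
  have hms := measurableSet_cylStrip R a
  have iE : IntegrableOn E (Icc ((0 : ℝ), -a) (R, a)) :=
    (integrableOn_mul_rpow R a hR (by linarith)
      (((cwz.pow 2).add (cwr.pow 2)).add (cG.mul cwz))).add
      ((integrableOn_mul_rpow R a hR (by linarith) (cw.pow 2)).const_mul _)
  have iD : IntegrableOn (fun q => fderiv ℝ A q (1, 0) + fderiv ℝ B q (0, 1))
      (Icc ((0 : ℝ), -a) (R, a)) := by
    rw [integrableOn_congr_set_ae hae] at iE ⊢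
    exact iE.congr_fun (fun q hq => (key q hq).symm) hms
  have hdiv := integral_divergence_prod_Icc_of_hasFDerivAt_off_countable_of_le A B
    (fderiv ℝ A) (fderiv ℝ B) ((0 : ℝ), -a) (R, a) ⟨hR.le, by simp; linarith⟩ ∅ countable_empty
    cA.continuousOn cB.continuousOn (fun q hq => (dA hq.1.1.1).hasFDerivAt)
    (fun q hq => (dB hq.1.1.1).hasFDerivAt) iD
  have hzero : ∀ {f : ℝ → ℝ} {b c : ℝ}, b ≤ c → (∀ x ∈ Ioo b c, f x = 0) →
      ∫ x in b..c, f x = 0 := by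
    intro f b c hbc hf
    rw [intervalIntegral.integral_of_le hbc, integral_Ioc_eq_integral_Ioo,
      setIntegral_congr_fun measurableSet_Ioo hf]
    simp
  rw [setIntegral_congr_set hae, setIntegral_congr_fun hms key, ← setIntegral_congr_set hae,
    hzero hR.le fun x hx => ?_, hzero hR.le fun x hx => ?_,
    hzero (by simp; linarith) fun x hx => ?_, hzero (by simp; linarith) fun x hx => ?_] at hdiv
  · simpa using hdiv
  · simp [hA, Real.zero_rpow (show 2 * μ + 1 ≠ 0 by linarith), hμ0.ne']
  · simp [hA, hlat x hx]
  · simp [hB, hbot x hx]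
  · simp [hB, htop x hx]

/-- Lemma 3.1, weighted estimate for the modified stream function:
there is `c > 0`, depending only on the cylinder, such that for every modified stream
function `ψ₁` with datum `Γ` and every `μ ∈ (0,1)`,
`∫_Ω (ψ₁,zzz² + ψ₁,rzz²) r^{2μ} + 2μ(1−μ) ∫_Ω ψ₁,zz² r^{2μ−2} ≤ c ∫_Ω Γ,z² r^{2μ}`. -/
theorem stmt_6 (R a : ℝ) (hR : 0 < R) (ha : 0 < a) :
    ∃ c > 0, ∀ ψ Γ : ℝ → ℝ → ℝ, ModStream R a ψ Γ →
      ∀ μ ∈ Ioo (0:ℝ) 1,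
        (∫ q, ((qdz (qdz (qdz ψ)) q.1 q.2) ^ 2 + (qdr (qdz (qdz ψ)) q.1 q.2) ^ 2)
            * q.1 ^ (2 * μ) ∂(cylMeas R a))
        + 2 * μ * (1 - μ) *
          (∫ q, (qdz (qdz ψ) q.1 q.2) ^ 2 * q.1 ^ (2 * μ - 2) ∂(cylMeas R a))
        ≤ c * ∫ q, (qdz Γ q.1 q.2) ^ 2 * q.1 ^ (2 * μ) ∂(cylMeas R a) := by
  refine ⟨1, one_pos, fun ψ Γ h μ hμ => ?_⟩
  have hψ := h.planeSmooth_ψ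
  have hΓ := h.planeSmooth_Γ
  have hS : StreamEq R a ψ Γ := h.eqn
  have hI := weighted_energy_identity hR ha hψ.qdz.qdz hΓ.qdz
    ((hS.qdz hψ hΓ).qdz hψ.qdz hΓ.qdz) (fun z hz => h.qdz_qdz_lat hz)
    (fun r hr => h.qdz_qdz_top hr ha (Or.inl rfl))
    (fun r hr => h.qdz_qdz_top hr ha (Or.inr rfl)) hμ
  obtain ⟨hμ0, hμ1⟩ := hμ
  set w := qdz (qdz ψ)
  set G := qdz Γ
  have hw : PlaneSmooth w := hψ.qdz.qdz
  have cw := hw.continuous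
  have cwr := hw.qdr.continuous
  have cwz := hw.qdz.continuous
  have cG : Continuous fun q : ℝ × ℝ => G q.1 q.2 := hΓ.qdz.continuous
  have hpow : ∀ (g : ℝ × ℝ → ℝ) (p : ℝ),
      ∫ q in Icc ((0 : ℝ), -a) (R, a), q.1 * (g q * q.1 ^ p)
        = ∫ q in Icc ((0 : ℝ), -a) (R, a), g q * q.1 ^ (p + 1) := by
    intro g p
    rw [setIntegral_congr_set (Icc_ae_eq_cylStrip R a),
      setIntegral_congr_set (Icc_ae_eq_cylStrip R a)]
    refine setIntegral_congr_fun (measurableSet_cylStrip R a) fun q hq => ?_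
    simp only [Real.rpow_add_one hq.1.1.ne']
    ring
  rw [integral_cylMeas, integral_cylMeas, integral_cylMeas, hpow, hpow, hpow,
    show 2 * μ - 2 + 1 = 2 * μ - 1 by ring]
  have i1 := integrableOn_mul_rpow R a hR (p := 2 * μ + 1) (by linarith)
    ((cwz.pow 2).add (cwr.pow 2))
  have i2 := (integrableOn_mul_rpow R a hR (p := 2 * μ - 1) (by linarith)
    (cw.pow 2)).const_mul (2 * μ * (1 - μ))
  have i3 := integrableOn_mul_rpow R a hR (p := 2 * μ + 1) (by linarith) (cG.pow 2)
  have i4 := ((integrableOn_mul_rpow R a hR (p := 2 * μ + 1) (by linarith)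
    (((cwz.pow 2).add (cwr.pow 2)).add (cG.mul cwz))).add i2).const_mul 2
  have hmono := setIntegral_mono_on (i1.add i2) (i3.add i4) measurableSet_Icc fun q hq => by
    have h0 : 0 ≤ q.1 := hq.1.1
    have hP := Real.rpow_nonneg h0 (2 * μ + 1)
    have hQ := Real.rpow_nonneg h0 (2 * μ - 1)
    have hm : 0 ≤ 2 * μ * (1 - μ) := mul_nonneg (by linarith) (by linarith)
    have k1 := mul_nonneg hm (mul_nonneg (sq_nonneg (w q.1 q.2)) hQ)
    have k2 := mul_nonneg (add_nonneg (sq_nonneg (qdz w q.1 q.2 + G q.1 q.2))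
      (sq_nonneg (qdr w q.1 q.2))) hP
    simp only [Pi.add_apply, Pi.pow_apply, Pi.mul_apply]
    linarith
  rw [integral_add' i1 i2, integral_add' i3 i4, integral_const_mul, integral_const_mul] at hmono
  simp only [Pi.add_apply, Pi.mul_apply, Pi.pow_apply] at hmono
  rw [hI] at hmono
  nlinarith [mul_le_mul_of_nonneg_left hmono Real.two_pi_pos.le]
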